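/- [Inequivalence of the CL and NC norms at p = 2] Let p = 2 and q > 2. For every constant K > 0 there exist positive integers n, m and a nonzero matrix Y ∈ M_n ⊗ M_m such that ‖Y‖_{CL} > K · ‖Y‖_{NC:2,q}. In particular there is a sequence of matrices Y^{(k)} ∈ M_{n_k} ⊗ M_{m_k} with ‖Y^{(k)}‖_{CL} / ‖Y^{(k)}‖_{NC:2,q} → ∞ as k → ∞, so the two norms are not equivalent up to dimension-independent constants. -/

import Mathlib

open scoped Kronecker
open Matrix
open scoped ENNReal NNReal ComplexOrder

noncomputable section

open scoped Classical in
/-- The Schatten `p`-norm of a complex square matrix, `p ∈ [1,∞]` (as an `ℝ≥0∞`).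
For finite `p` it equals `(Tr |A|^p)^{1/p}`, computed via the eigenvalues of `Aᴴ * A`;
for `p = ∞` it is the operator norm (largest singular value). -/
noncomputable def schattenNorm {k : Type*} [Fintype k] [DecidableEq k] (p : ℝ≥0∞)
    (A : Matrix k k ℂ) : ℝ :=
  if p = ⊤ then
    ⨆ i, Real.sqrt ((Matrix.posSemidef_conjTranspose_mul_self A).isHermitian.eigenvalues i)
  else
    (∑ i, (Matrix.posSemidef_conjTranspose_mul_self A).isHermitian.eigenvalues i
        ^ (p.toReal / 2)) ^ (1 / p.toReal)

/-- `r` defined by `1/r = max{1/p, 1/q} - min{1/p, 1/q}` (so `r = ∞` when `p = q`). -/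
noncomputable def ncR (p q : ℝ≥0∞) : ℝ≥0∞ := (max p⁻¹ q⁻¹ - min p⁻¹ q⁻¹)⁻¹

/-- The non-commutative `L^q(L^p)` norm (supremum form, used when `p ≤ q`):
`sup_{A,B} ‖(A ⊗ I) Y (B ⊗ I)‖_p / (‖A‖_{2r} ‖B‖_{2r})`. -/
noncomputable def ncNormSup {k l : Type*} [Fintype k] [DecidableEq k] [Fintype l] [DecidableEq l]
    (p q : ℝ≥0∞) (Y : Matrix (k × l) (k × l) ℂ) : ℝ :=
  ⨆ A : Matrix k k ℂ, ⨆ B : Matrix k k ℂ,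
    schattenNorm p ((A ⊗ₖ (1 : Matrix l l ℂ)) * Y * (B ⊗ₖ (1 : Matrix l l ℂ))) /
      (schattenNorm (2 * ncR p q) A * schattenNorm (2 * ncR p q) B)

/-- The non-commutative `L^q(L^p)` norm (infimum form, used when `q ≤ p`):
`inf { ∑ᵢ ‖Aᵢ‖_{2r} ‖Bᵢ‖_{2r} ‖Zᵢ‖_p : Y = ∑ᵢ (Aᵢ ⊗ I) Zᵢ (Bᵢ ⊗ I) }`. -/
noncomputable def ncNormInf {k l : Type*} [Fintype k] [DecidableEq k] [Fintype l] [DecidableEq l]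
    (p q : ℝ≥0∞) (Y : Matrix (k × l) (k × l) ℂ) : ℝ :=
  sInf { s : ℝ | ∃ (N : ℕ) (A B : Fin N → Matrix k k ℂ)
      (Z : Fin N → Matrix (k × l) (k × l) ℂ),
    Y = ∑ i, (A i ⊗ₖ (1 : Matrix l l ℂ)) * Z i * (B i ⊗ₖ (1 : Matrix l l ℂ)) ∧
    s = ∑ i, schattenNorm (2 * ncR p q) (A i) * schattenNorm (2 * ncR p q) (B i) *
          schattenNorm p (Z i) }

open scoped Classical in
/-- The non-commutative `L^q(L^p)` norm `‖·‖_{NC:p,q}`. -/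
noncomputable def ncNorm {k l : Type*} [Fintype k] [DecidableEq k] [Fintype l] [DecidableEq l]
    (p q : ℝ≥0∞) (Y : Matrix (k × l) (k × l) ℂ) : ℝ :=
  if p ≤ q then ncNormSup p q Y else ncNormInf p q Y

open scoped Classical in
/-- Real power of a Hermitian matrix via the spectral decomposition (junk value `0` on
non-Hermitian matrices). -/
noncomputable def mrpow {k : Type*} [Fintype k] [DecidableEq k] (A : Matrix k k ℂ) (e : ℝ) :
    Matrix k k ℂ :=
  if hA : A.IsHermitian then
    (hA.eigenvectorUnitary : Matrix k k ℂ) *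
      Matrix.diagonal (fun i => ((hA.eigenvalues i ^ e : ℝ) : ℂ)) *
      ((hA.eigenvectorUnitary : Matrix k k ℂ))ᴴ
  else 0

/-- Partial trace over the second (inside) factor. -/
noncomputable def ptrace2 {k l : Type*} [Fintype l]
    (Y : Matrix (k × l) (k × l) ℂ) : Matrix k k ℂ :=
  fun i i' => ∑ j : l, Y (i, j) (i', j)

/-- The Carlen–Lieb quantity `Ψ_{p,q}(Y) = (Tr₁ (Tr₂ Y^p)^{q/p})^{1/q}`. -/
noncomputable def Psi {k l : Type*} [Fintype k] [DecidableEq k] [Fintype l] [DecidableEq l]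
    (p q : ℝ) (Y : Matrix (k × l) (k × l) ℂ) : ℝ :=
  (Matrix.trace (mrpow (ptrace2 (mrpow Y p)) (q / p))).re ^ (1 / q)

/-- The quantity `|||X|||_{p,q} = inf {Ψ_{p,q}(A) + Ψ_{p,q}(B) : X + A = B, A ≥ 0, B ≥ 0}`,
for `X` on the space `M_k ⊗ (M_l ⊗ M_2)`. -/
noncomputable def tripleNorm {k l : Type*} [Fintype k] [DecidableEq k] [Fintype l] [DecidableEq l]
    (p q : ℝ) (X : Matrix (k × (l × Fin 2)) (k × (l × Fin 2)) ℂ) : ℝ :=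
  sInf { s : ℝ | ∃ A B : Matrix (k × (l × Fin 2)) (k × (l × Fin 2)) ℂ,
    A.PosSemidef ∧ B.PosSemidef ∧ X + A = B ∧ s = Psi p q A + Psi p q B }

/-- The block matrix `[[0, Y],[Yᴴ, 0]]`, viewed in `M_k ⊗ (M_l ⊗ M_2)`. -/
noncomputable def clBlock {k l : Type*} (Y : Matrix (k × l) (k × l) ℂ) :
    Matrix (k × (l × Fin 2)) (k × (l × Fin 2)) ℂ :=
  fun x y =>
    if x.2.2 = 0 ∧ y.2.2 = 1 then Y (x.1, x.2.1) (y.1, y.2.1)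
    else if x.2.2 = 1 ∧ y.2.2 = 0 then star (Y (y.1, y.2.1) (x.1, x.2.1))
    else 0

/-- The block-diagonal matrix `diag(P, Q) = [[P, 0],[0, Q]]`, viewed in `M_k ⊗ (M_l ⊗ M_2)`. -/
noncomputable def blockDiag2 {k l : Type*} (P Q : Matrix (k × l) (k × l) ℂ) :
    Matrix (k × (l × Fin 2)) (k × (l × Fin 2)) ℂ :=
  fun x y =>
    if x.2.2 = 0 ∧ y.2.2 = 0 then P (x.1, x.2.1) (y.1, y.2.1)
    else if x.2.2 = 1 ∧ y.2.2 = 1 then Q (x.1, x.2.1) (y.1, y.2.1)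
    else 0

/-- The Carlen–Lieb norm `‖Y‖_{CL} = (1/2) ||| [[0,Y],[Yᴴ,0]] |||_{p,q}`. -/
noncomputable def clNorm {k l : Type*} [Fintype k] [DecidableEq k] [Fintype l] [DecidableEq l]
    (p q : ℝ) (Y : Matrix (k × l) (k × l) ℂ) : ℝ :=
  (1 / 2) * tripleNorm p q (clBlock Y)

end

/-- A nonnegative number is at most the `ℓ^p` norm of any nonnegative family containing it. -/
lemma le_sum_rpow_rpow_inv {k : Type*} [Fintype k] {f : k → ℝ} (hf : ∀ i, 0 ≤ f i)
    {p : ℝ} (hp : 0 < p) (i : k) :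
    f i ≤ (∑ j, f j ^ p) ^ (1 / p) := by
  have h : f i ^ p ≤ ∑ j, f j ^ p :=
    Finset.single_le_sum (f := fun j => f j ^ p) (fun j _ => Real.rpow_nonneg (hf j) p)
      (Finset.mem_univ i)
  calc f i = (f i ^ p) ^ (1 / p) := by
        rw [← Real.rpow_mul (hf i), mul_one_div_cancel hp.ne', Real.rpow_one]
    _ ≤ _ := Real.rpow_le_rpow (Real.rpow_nonneg (hf i) p) h (by positivity)

lemma re_conjTranspose_mul_self_diag {k : Type*} [Fintype k] (A : Matrix k k ℂ) (a : k) :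
    ((Aᴴ * A) a a).re = ∑ i, ‖A i a‖ ^ 2 := by
  simp only [Matrix.mul_apply, Matrix.conjTranspose_apply, Complex.re_sum]
  refine Finset.sum_congr rfl fun i _ => ?_
  rw [← Complex.normSq_eq_norm_sq, Complex.normSq_apply]
  simp

/-- The partial trace of a positive semidefinite matrix is positive semidefinite. -/
lemma Matrix.PosSemidef.ptrace2 {k l : Type*} [Fintype l]
    {Y : Matrix (k × l) (k × l) ℂ} (hY : Y.PosSemidef) :
    (ptrace2 Y).PosSemidef := by
  have h : _root_.ptrace2 Y = ∑ j : l, Y.submatrix (fun i => (i, j)) (fun i => (i, j)) := by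
    ext a b
    simp [_root_.ptrace2, Matrix.sum_apply]
  rw [h]
  exact Matrix.posSemidef_sum _ fun j _ => hY.submatrix _

lemma clBlock_isHermitian {k l : Type*} (Y : Matrix (k × l) (k × l) ℂ) :
    (clBlock Y).IsHermitian := by
  ext ⟨a, b, c⟩ ⟨a', b', c'⟩
  fin_cases c <;> fin_cases c' <;> simp [clBlock]

section SpectralBounds

variable {k : Type*} [Fintype k] [DecidableEq k]

/-- Diagonal entries of a Hermitian matrix are bounded by any bound on its eigenvalues. -/
lemma Matrix.IsHermitian.re_diag_le {T : Matrix k k ℂ} (hT : T.IsHermitian) {c : ℝ}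
    (hc : ∀ i, hT.eigenvalues i ≤ c) (a : k) : (T a a).re ≤ c := by
  have hspec : T a a = ∑ i, (hT.eigenvalues i : ℂ) *
      (Complex.normSq ((hT.eigenvectorUnitary : Matrix k k ℂ) a i) : ℂ) := by
    conv_lhs => rw [hT.spectral_theorem]
    rw [Unitary.conjStarAlgAut_apply, Matrix.mul_apply]
    refine Finset.sum_congr rfl fun i _ => ?_
    rw [Matrix.mul_diagonal, Complex.normSq_eq_conj_mul_self, Matrix.star_apply]
    simp only [Function.comp_apply, RCLike.star_def]
    rw [mul_comm _ (RCLike.ofReal _ : ℂ), mul_assoc, mul_comm ((starRingEnd ℂ) _)]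
    rfl
  have hone : ∑ i, Complex.normSq ((hT.eigenvectorUnitary : Matrix k k ℂ) a i) = 1 := by
    have h := congrFun (congrFun (Unitary.coe_mul_star_self hT.eigenvectorUnitary) a) a
    simp only [Matrix.mul_apply, Matrix.one_apply_eq] at h
    have h' : ((∑ i, Complex.normSq ((hT.eigenvectorUnitary : Matrix k k ℂ) a i) : ℝ) : ℂ) = 1 := by
      rw [← h]
      push_cast
      refine Finset.sum_congr rfl fun i _ => ?_
      rw [Complex.normSq_eq_conj_mul_self, mul_comm]
      rfl
    exact_mod_cast h'
  have hre : (T a a).re = ∑ i, hT.eigenvalues i *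
      Complex.normSq ((hT.eigenvectorUnitary : Matrix k k ℂ) a i) := by
    rw [hspec, ← Complex.ofReal_re (∑ i, _)]
    push_cast
    rfl
  calc (T a a).re ≤ ∑ i, c * Complex.normSq ((hT.eigenvectorUnitary : Matrix k k ℂ) a i) := by
        rw [hre]
        exact Finset.sum_le_sum fun i _ =>
          mul_le_mul_of_nonneg_right (hc i) (Complex.normSq_nonneg _)
    _ = c := by rw [← Finset.mul_sum, hone, mul_one]

/-- Diagonal entries of a positive semidefinite matrix are bounded by its Schatten norms. -/
lemma Matrix.PosSemidef.re_diag_le {T : Matrix k k ℂ} (hT : T.PosSemidef) {p : ℝ} (hp : 0 < p)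
    (a : k) : (T a a).re ≤ (∑ i, hT.isHermitian.eigenvalues i ^ p) ^ (1 / p) :=
  hT.isHermitian.re_diag_le (le_sum_rpow_rpow_inv hT.eigenvalues_nonneg hp) a

lemma sum_eigenvalues_conjTranspose_mul_self (A : Matrix k k ℂ) :
    ∑ i, (Matrix.posSemidef_conjTranspose_mul_self A).isHermitian.eigenvalues i =
      ∑ j, ∑ i, ‖A i j‖ ^ 2 := by
  have h := (Matrix.posSemidef_conjTranspose_mul_self A).isHermitian.trace_eq_sum_eigenvalues
  have h' := congrArg Complex.re h
  rw [Matrix.trace, Complex.re_sum, Complex.re_sum] at h'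
  simp only [Matrix.diag_apply, re_conjTranspose_mul_self_diag] at h'
  rw [h']
  rfl

end SpectralBounds

section Schatten

variable {k : Type*} [Fintype k] [DecidableEq k]

lemma schattenNorm_nonneg {p : ℝ≥0∞} (hp : p ≠ ⊤) (A : Matrix k k ℂ) : 0 ≤ schattenNorm p A := by
  rw [schattenNorm, if_neg hp]
  exact Real.rpow_nonneg (Finset.sum_nonneg fun i _ => Real.rpow_nonneg
    ((Matrix.posSemidef_conjTranspose_mul_self A).eigenvalues_nonneg i) _) _

lemma schattenNorm_sq {p : ℝ≥0∞} (hp : p ≠ ⊤) (A : Matrix k k ℂ) :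
    schattenNorm p A ^ 2 =
      (∑ i, (Matrix.posSemidef_conjTranspose_mul_self A).isHermitian.eigenvalues i
        ^ (p.toReal / 2)) ^ (1 / (p.toReal / 2)) := by
  rw [schattenNorm, if_neg hp, ← Real.rpow_natCast, ← Real.rpow_mul]
  · congr 1
    push_cast
    rw [one_div_div]
    ring
  · exact Finset.sum_nonneg fun i _ => Real.rpow_nonneg
      ((Matrix.posSemidef_conjTranspose_mul_self A).eigenvalues_nonneg i) _

lemma schattenNorm_two_sq (A : Matrix k k ℂ) :
    schattenNorm 2 A ^ 2 = ∑ j, ∑ i, ‖A i j‖ ^ 2 := by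
  rw [schattenNorm_sq (by simp), ← sum_eigenvalues_conjTranspose_mul_self]
  simp

/-- Columns of a matrix are bounded in `ℓ²` by its Schatten norms. -/
lemma sum_norm_sq_col_le_schattenNorm_sq {p : ℝ≥0∞} (hp : p ≠ ⊤) (hp0 : 0 < p.toReal)
    (A : Matrix k k ℂ) (a : k) : ∑ i, ‖A i a‖ ^ 2 ≤ schattenNorm p A ^ 2 := by
  rw [schattenNorm_sq hp, ← re_conjTranspose_mul_self_diag]
  exact (Matrix.posSemidef_conjTranspose_mul_self A).re_diag_le (by positivity) a

/-- Hölder comparison of the Schatten `2`-norm with the Schatten `p`-norm for `p ≥ 2`. -/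
lemma sum_norm_sq_le_card_rpow_mul_schattenNorm_sq {p : ℝ≥0∞} (hp : p ≠ ⊤) (hp2 : 2 ≤ p.toReal)
    (A : Matrix k k ℂ) : ∑ j, ∑ i, ‖A i j‖ ^ 2 ≤
      (Fintype.card k : ℝ) ^ (1 - 2 / p.toReal) * schattenNorm p A ^ 2 := by
  set t := p.toReal with ht
  have ht1 : 1 ≤ t / 2 := by linarith
  have hnn := (Matrix.posSemidef_conjTranspose_mul_self A).eigenvalues_nonneg
  rw [schattenNorm_sq hp, ← sum_eigenvalues_conjTranspose_mul_self, ← ht]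
  set f := (Matrix.posSemidef_conjTranspose_mul_self A).isHermitian.eigenvalues with hf
  have h := Real.rpow_sum_le_const_mul_sum_rpow_of_nonneg (s := Finset.univ) (f := f) ht1
    (fun i _ => hnn i)
  have hS : 0 ≤ ∑ i, f i := Finset.sum_nonneg fun i _ => hnn i
  have hP : 0 ≤ ∑ i, f i ^ (t / 2) := Finset.sum_nonneg fun i _ => Real.rpow_nonneg (hnn i) _
  calc ∑ i, f i = ((∑ i, f i) ^ (t / 2)) ^ (1 / (t / 2)) := by
        rw [← Real.rpow_mul hS, mul_one_div_cancel (by linarith), Real.rpow_one]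
    _ ≤ ((Finset.univ.card : ℝ) ^ (t / 2 - 1) * ∑ i, f i ^ (t / 2)) ^ (1 / (t / 2)) :=
        Real.rpow_le_rpow (Real.rpow_nonneg hS _) h (by positivity)
    _ = _ := by
        rw [Real.mul_rpow (by positivity) hP, ← Real.rpow_mul (by positivity), Finset.card_univ]
        congr 2
        field_simp

end Schatten

section CarlenLieb

variable {k l : Type*} [Fintype k] [DecidableEq k] [Fintype l] [DecidableEq l]

lemma mrpow_two {A : Matrix k k ℂ} (hA : A.IsHermitian) : mrpow A 2 = Aᴴ * A := by
  have hU : (hA.eigenvectorUnitary : Matrix k k ℂ)ᴴ * (hA.eigenvectorUnitary : Matrix k k ℂ) = 1 :=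
    Unitary.coe_star_mul_self hA.eigenvectorUnitary
  have hspec : A = (hA.eigenvectorUnitary : Matrix k k ℂ) *
      Matrix.diagonal (fun i => (hA.eigenvalues i : ℂ)) *
      (hA.eigenvectorUnitary : Matrix k k ℂ)ᴴ := by
    conv_lhs => rw [hA.spectral_theorem, Unitary.conjStarAlgAut_apply]
    rfl
  rw [hA.eq, mrpow, dif_pos hA]
  set U := (hA.eigenvectorUnitary : Matrix k k ℂ) with hUdef
  set D := Matrix.diagonal (fun i => (hA.eigenvalues i : ℂ)) with hD
  have hDD : Matrix.diagonal (fun i => ((hA.eigenvalues i ^ (2 : ℝ) : ℝ) : ℂ)) = D * D := by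
    rw [hD, Matrix.diagonal_mul_diagonal]
    congr 1
    funext i
    rw [Real.rpow_two]
    push_cast
    ring
  rw [hDD]
  conv_rhs => rw [hspec]
  calc U * (D * D) * Uᴴ = U * D * (1 : Matrix k k ℂ) * D * Uᴴ := by
        simp only [Matrix.mul_one, Matrix.mul_assoc]
    _ = _ := by rw [← hU]; simp only [Matrix.mul_assoc]

lemma trace_mrpow {A : Matrix k k ℂ} (hA : A.IsHermitian) (e : ℝ) :
    (Matrix.trace (mrpow A e)).re = ∑ i, hA.eigenvalues i ^ e := by
  have hU : (hA.eigenvectorUnitary : Matrix k k ℂ)ᴴ * (hA.eigenvectorUnitary : Matrix k k ℂ) = 1 :=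
    Unitary.coe_star_mul_self hA.eigenvectorUnitary
  rw [mrpow, dif_pos hA, Matrix.trace_mul_comm, ← Matrix.mul_assoc, hU, Matrix.one_mul,
    Matrix.trace_diagonal, Complex.re_sum]
  simp only [Complex.ofReal_re]

/-- `Ψ_{2,q}` dominates the `ℓ²` norm of every column of a Hermitian matrix. -/
lemma sqrt_sum_norm_sq_col_le_Psi {A : Matrix (k × l) (k × l) ℂ} (hA : A.IsHermitian) {q : ℝ}
    (hq : 0 < q) (a : k × l) : √(∑ y, ‖A y a‖ ^ 2) ≤ Psi 2 q A := by
  have hT := (Matrix.posSemidef_conjTranspose_mul_self A).ptrace2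
  rw [Psi, mrpow_two hA, trace_mrpow hT.isHermitian]
  have hP : 0 ≤ ∑ i, hT.isHermitian.eigenvalues i ^ (q / 2) :=
    Finset.sum_nonneg fun i _ => Real.rpow_nonneg (hT.eigenvalues_nonneg i) _
  refine Real.sqrt_le_iff.2 ⟨Real.rpow_nonneg hP _, ?_⟩
  calc ∑ y, ‖A y a‖ ^ 2 = ((Aᴴ * A) a a).re := (re_conjTranspose_mul_self_diag A a).symm
    _ ≤ ∑ j, ((Aᴴ * A) (a.1, j) (a.1, j)).re := by
        refine Finset.single_le_sum (f := fun j => ((Aᴴ * A) (a.1, j) (a.1, j)).re)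
          (fun j _ => ?_) (Finset.mem_univ a.2)
        simp only [re_conjTranspose_mul_self_diag]
        positivity
    _ = (ptrace2 (Aᴴ * A) a.1 a.1).re := by simp only [ptrace2, Complex.re_sum]
    _ ≤ (∑ i, hT.isHermitian.eigenvalues i ^ (q / 2)) ^ (1 / (q / 2)) :=
        hT.re_diag_le (by positivity) a.1
    _ = ((∑ i, hT.isHermitian.eigenvalues i ^ (q / 2)) ^ (1 / q)) ^ 2 := by
        rw [← Real.rpow_natCast, ← Real.rpow_mul hP]
        congr 1
        push_cast
        rw [one_div_div]
        ring

/-- Every Hermitian matrix is a difference of two positive semidefinite matrices. -/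
lemma Matrix.IsHermitian.exists_posSemidef_add_eq {X : Matrix k k ℂ} (hX : X.IsHermitian) :
    ∃ A B : Matrix k k ℂ, A.PosSemidef ∧ B.PosSemidef ∧ X + A = B := by
  have h4 : (0 : ℂ) ≤ 1 / 4 := by
    rw [show (1 / 4 : ℂ) = ((1 / 4 : ℝ) : ℂ) by push_cast; rfl]
    exact Complex.zero_le_real.2 (by norm_num)
  refine ⟨(1 / 4 : ℂ) • ((X - 1)ᴴ * (X - 1)), (1 / 4 : ℂ) • ((X + 1)ᴴ * (X + 1)),
    (Matrix.posSemidef_conjTranspose_mul_self _).smul h4,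
    (Matrix.posSemidef_conjTranspose_mul_self _).smul h4, ?_⟩
  rw [Matrix.conjTranspose_sub, Matrix.conjTranspose_add, hX.eq, Matrix.conjTranspose_one]
  simp only [sub_mul, mul_sub, add_mul, mul_add, Matrix.mul_one, Matrix.one_mul]
  module

lemma sqrt_sum_norm_sq_sub_le {ι : Type*} [Fintype ι] (f g : ι → ℂ) :
    √(∑ i, ‖f i - g i‖ ^ 2) ≤ √(∑ i, ‖f i‖ ^ 2) + √(∑ i, ‖g i‖ ^ 2) := by
  have h := norm_sub_le (WithLp.toLp 2 f : EuclideanSpace ℂ ι) (WithLp.toLp 2 g)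
  simpa [EuclideanSpace.norm_eq] using h

/-- `|||X|||_{2,q}` dominates the `ℓ²` norm of every column of `X`. -/
lemma sqrt_sum_norm_sq_col_le_tripleNorm {X : Matrix (k × (l × Fin 2)) (k × (l × Fin 2)) ℂ}
    (hX : X.IsHermitian) {q : ℝ} (hq : 0 < q) (a : k × (l × Fin 2)) :
    √(∑ y, ‖X y a‖ ^ 2) ≤ tripleNorm 2 q X := by
  refine le_csInf ?_ ?_
  · obtain ⟨A, B, hA, hB, h⟩ := hX.exists_posSemidef_add_eq
    exact ⟨_, A, B, hA, hB, h, rfl⟩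
  · rintro s ⟨A, B, hA, hB, h, rfl⟩
    have hXe : ∀ y, X y a = B y a - A y a := fun y => by
      rw [← h, Matrix.add_apply, add_sub_cancel_right]
    simp only [hXe]
    rw [add_comm]
    exact (sqrt_sum_norm_sq_sub_le _ _).trans (add_le_add
      (sqrt_sum_norm_sq_col_le_Psi hB.isHermitian hq a)
      (sqrt_sum_norm_sq_col_le_Psi hA.isHermitian hq a))

/-- The Carlen–Lieb norm dominates half the `ℓ²` norm of every row. -/
lemma half_sqrt_sum_norm_sq_row_le_clNorm (Y : Matrix (k × l) (k × l) ℂ) {q : ℝ} (hq : 0 < q)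
    (a : k × l) : 1 / 2 * √(∑ y, ‖Y a y‖ ^ 2) ≤ clNorm 2 q Y := by
  rw [clNorm]
  refine mul_le_mul_of_nonneg_left (le_trans (Real.sqrt_le_sqrt ?_)
    (sqrt_sum_norm_sq_col_le_tripleNorm (clBlock_isHermitian Y) hq (a.1, a.2, 0))) (by norm_num)
  simp only [Fintype.sum_prod_type, Fin.sum_univ_two]
  refine Finset.sum_le_sum fun i _ => Finset.sum_le_sum fun j _ => ?_
  simp [clBlock]

end CarlenLieb

section BasisEntangled

variable {k : Type*} [Fintype k] [DecidableEq k]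

/-- The rank-one matrix `|e_a ⊗ e_a⟩⟨∑ᵢ e_i ⊗ e_i|`. -/
def basisEntangled (a : k) : Matrix (k × k) (k × k) ℂ :=
  fun x y => if x = (a, a) ∧ y.1 = y.2 then 1 else 0

lemma sum_norm_sq_row_basisEntangled (a : k) :
    ∑ y, ‖basisEntangled a (a, a) y‖ ^ 2 = (Fintype.card k : ℝ) := by
  rw [Fintype.sum_prod_type]
  have h : ∀ x y : k, ‖basisEntangled a (a, a) (x, y)‖ ^ 2 = if x = y then (1 : ℝ) else 0 := by
    intro x y
    by_cases hxy : x = y <;> simp [basisEntangled, hxy]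
  simp [h]

lemma kronecker_mul_basisEntangled_mul_kronecker (a : k) (A B : Matrix k k ℂ) (x y : k × k) :
    ((A ⊗ₖ (1 : Matrix k k ℂ)) * basisEntangled a * (B ⊗ₖ (1 : Matrix k k ℂ))) x y =
      A x.1 a * (if x.2 = a then 1 else 0) * B y.2 y.1 := by
  have h1 : ∀ z : k × k, ((A ⊗ₖ (1 : Matrix k k ℂ)) * basisEntangled a) x z =
      (A x.1 a * (if x.2 = a then 1 else 0)) * (if z.1 = z.2 then 1 else 0) := by
    intro z
    rw [Matrix.mul_apply, Finset.sum_eq_single (a, a)]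
    · simp [basisEntangled, Matrix.kroneckerMap_apply, Matrix.one_apply]
    · intro w _ hw
      simp [basisEntangled, hw]
    · simp
  rw [Matrix.mul_apply, Finset.sum_eq_single (y.2, y.2)]
  · simp [h1, Matrix.kroneckerMap_apply]
  · rintro ⟨w, w'⟩ _ hw
    rw [h1, Matrix.kroneckerMap_apply, Matrix.one_apply]
    by_cases h : w = w'
    · subst h
      have : w ≠ y.2 := fun h => hw (by rw [h])
      simp [this]
    · simp [h]
  · simp

lemma schattenNorm_two_kronecker_mul_basisEntangled_sq (a : k) (A B : Matrix k k ℂ) :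
    schattenNorm 2 ((A ⊗ₖ (1 : Matrix k k ℂ)) * basisEntangled a * (B ⊗ₖ (1 : Matrix k k ℂ))) ^ 2 =
      (∑ i, ‖A i a‖ ^ 2) * ∑ j, ∑ i, ‖B i j‖ ^ 2 := by
  rw [schattenNorm_two_sq]
  simp only [kronecker_mul_basisEntangled_mul_kronecker, Fintype.sum_prod_type]
  rw [Finset.mul_sum]
  refine Finset.sum_congr rfl fun j _ => ?_
  rw [Finset.mul_sum]
  refine Finset.sum_congr rfl fun i _ => ?_
  rw [Finset.sum_mul]
  refine Finset.sum_congr rfl fun i' _ => ?_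
  rw [Finset.sum_eq_single a]
  · simp [mul_pow]
  · intro b _ hb
    simp [hb]
  · simp

lemma ncNormSup_basisEntangled_le {p q : ℝ≥0∞} (hp : p = 2) (hr : 2 * ncR p q ≠ ⊤)
    (hr2 : 2 ≤ (2 * ncR p q).toReal) (a : k) :
    ncNormSup p q (basisEntangled a) ≤
      (Fintype.card k : ℝ) ^ (1 / 2 - 1 / (2 * ncR p q).toReal) := by
  have hN : (0 : ℝ) ≤ (Fintype.card k : ℝ) ^ (1 / 2 - 1 / (2 * ncR p q).toReal) := by positivity
  refine Real.iSup_le (fun A => Real.iSup_le (fun B => ?_) hN) hN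
  have hA := schattenNorm_nonneg hr A
  have hB := schattenNorm_nonneg hr B
  refine div_le_of_le_mul₀ (mul_nonneg hA hB) hN ?_
  refine (sq_le_sq₀ (schattenNorm_nonneg (by simp [hp]) _) (mul_nonneg hN (mul_nonneg hA hB))).1 ?_
  subst hp
  rw [schattenNorm_two_kronecker_mul_basisEntangled_sq]
  refine (mul_le_mul (sum_norm_sq_col_le_schattenNorm_sq hr (by linarith) A a)
    (sum_norm_sq_le_card_rpow_mul_schattenNorm_sq hr hr2 B) (by positivity)
    (by positivity)).trans_eq ?_
  rw [mul_pow, mul_pow, ← Real.rpow_natCast ((Fintype.card k : ℝ) ^ _),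
    ← Real.rpow_mul (by positivity)]
  rw [show (1 / 2 - 1 / (2 * ncR 2 q).toReal) * ((2 : ℕ) : ℝ) = 1 - 2 / (2 * ncR 2 q).toReal by
    push_cast; ring]
  ring

lemma two_mul_ncR_two {q : ℝ} (hq : 2 < q) :
    2 * ncR 2 (ENNReal.ofReal q) = ENNReal.ofReal (2 * (1 / 2 - 1 / q)⁻¹) := by
  have hq0 : 0 < q := by linarith
  have hlt : q⁻¹ < 2⁻¹ := inv_strictAnti₀ (by norm_num) hq
  have h2 : (2 : ℝ≥0∞)⁻¹ = ENNReal.ofReal 2⁻¹ := by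
    rw [ENNReal.ofReal_inv_of_pos (by norm_num)]
    simp
  have hle : ENNReal.ofReal q⁻¹ ≤ ENNReal.ofReal 2⁻¹ := ENNReal.ofReal_le_ofReal hlt.le
  rw [ncR, h2, ← ENNReal.ofReal_inv_of_pos hq0, max_eq_left hle, min_eq_right hle,
    ← ENNReal.ofReal_sub _ (by positivity), ← ENNReal.ofReal_inv_of_pos (by linarith),
    ENNReal.ofReal_mul (by norm_num)]
  simp

end BasisEntangled

/-- **Inequivalence of the Carlen–Lieb and NC norms at `p = 2`, `q > 2`**: the ratio
`‖Y‖_CL/‖Y‖_{NC:2,q}` is unbounded over matrices of varying dimension. -/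
theorem clNorm_div_ncNorm_unbounded (q : ℝ) (hq : 2 < q) :
    ∀ K : ℝ, 0 < K → ∃ (n m : ℕ), 0 < n ∧ 0 < m ∧
      ∃ Y : Matrix (Fin n × Fin m) (Fin n × Fin m) ℂ, Y ≠ 0 ∧
        K * ncNormSup (2 : ℝ≥0∞) (ENNReal.ofReal q) Y < clNorm 2 q Y := by
  intro K hK
  set σ : ℝ := 2 * (1 / 2 - 1 / q)⁻¹ with hσ
  have hq' : 0 < 1 / q ∧ 1 / q < 1 / 2 :=
    ⟨by positivity, one_div_lt_one_div_of_lt (by norm_num) hq⟩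
  have hσ2 : 2 ≤ σ := by
    have : 1 ≤ (1 / 2 - 1 / q)⁻¹ := one_le_inv₀ (by linarith) |>.2 (by linarith)
    linarith
  have hr := two_mul_ncR_two hq
  have hrT : (2 * ncR 2 (ENNReal.ofReal q)).toReal = σ := by
    rw [hr, ENNReal.toReal_ofReal (by linarith)]
  obtain ⟨N, hN⟩ := (((tendsto_rpow_atTop (y := 1 / σ) (by positivity)).comp
    tendsto_natCast_atTop_atTop).eventually (Filter.eventually_gt_atTop (2 * K))).and
    (Filter.eventually_gt_atTop 0) |>.exists
  obtain ⟨hNK, hN0⟩ := hN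
  have : NeZero N := ⟨hN0.ne'⟩
  have hNpos : (0 : ℝ) < N := by exact_mod_cast hN0
  refine ⟨N, N, hN0, hN0, basisEntangled 0, ?_, ?_⟩
  · intro h
    have := congrFun (congrFun h (0, 0)) (0, 0)
    simp [basisEntangled] at this
  · have hnc := ncNormSup_basisEntangled_le (q := ENNReal.ofReal q) rfl
      (by rw [hr]; exact ENNReal.ofReal_ne_top) (by rw [hrT]; exact hσ2) (0 : Fin N)
    have hcl := half_sqrt_sum_norm_sq_row_le_clNorm (basisEntangled (0 : Fin N))
      (q := q) (by linarith) (0, 0)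
    rw [sum_norm_sq_row_basisEntangled, Fintype.card_fin] at hcl
    rw [hrT, Fintype.card_fin] at hnc
    have hsplit : √(N : ℝ) = (N : ℝ) ^ (1 / σ) * (N : ℝ) ^ (1 / 2 - 1 / σ) := by
      rw [← Real.rpow_add hNpos, Real.sqrt_eq_rpow]
      congr 1
      ring
    have hM : 0 < (N : ℝ) ^ (1 / 2 - 1 / σ) := Real.rpow_pos_of_pos hNpos _
    have hNK' : 2 * K < (N : ℝ) ^ (1 / σ) := hNK
    calc K * ncNormSup 2 (ENNReal.ofReal q) (basisEntangled (0 : Fin N))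
        ≤ K * (N : ℝ) ^ (1 / 2 - 1 / σ) := mul_le_mul_of_nonneg_left hnc hK.le
      _ < 1 / 2 * √(N : ℝ) := by
          rw [hsplit]
          nlinarith [mul_lt_mul_of_pos_right hNK' hM]
      _ ≤ _ := hcl
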